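/- Let m ≥ 0, β > 0, ω_p = √(‖p‖² + m²), and for ξ ∈ ℝ⁴, 0 < σ < β let F(ξ, σ) = (2π)⁻³ ∫_{ℝ³} (2ω_p)⁻¹ (1 − e^{−βω_p})⁻¹ ( e^{i(ω_p(ξ₀+iσ) − ⟨p,ξ⃗⟩)} + e^{−i(ω_p(ξ₀+iσ) − ⟨p,ξ⃗⟩)} e^{−βω_p} ) dp. Then F satisfies the KMS reflection symmetry F(−ξ, β−σ) = F(ξ, σ) for all ξ ∈ ℝ⁴ and 0 < σ < β. (This is the local KMS boundary-exchange property: the boundary value at Im z₀ = β of the analytically continued two-point function equals the boundary value at Im z₀ = 0 with ξ replaced by −ξ.) -/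

import Mathlib

open MeasureTheory Real Complex
open scoped RealInnerProductSpace

/-- Relativistic energy ω_p = √(‖p‖² + m²). -/
noncomputable def omega (m : ℝ) (p : EuclideanSpace ℝ (Fin 3)) : ℝ :=
  Real.sqrt (‖p‖ ^ 2 + m ^ 2)

/-- The analytically continued thermal two-point function
    F(ξ, σ) = (2π)⁻³ ∫_{ℝ³} (2ω_p)⁻¹(1 − e^{−βω_p})⁻¹
      ( e^{i(ω_p(ξ₀+iσ) − ⟨p,ξ⃗⟩)} + e^{−i(ω_p(ξ₀+iσ) − ⟨p,ξ⃗⟩)} e^{−βω_p} ) dp. -/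
noncomputable def thermalF (m β ξ₀ : ℝ) (ξv : EuclideanSpace ℝ (Fin 3))
    (σ : ℝ) : ℂ :=
  (((2 * Real.pi) ^ 3)⁻¹ : ℝ) •
    ∫ p : EuclideanSpace ℝ (Fin 3),
      (((2 * omega m p)⁻¹ * (1 - Real.exp (-β * omega m p))⁻¹ : ℝ) : ℂ) *
        (Complex.exp (Complex.I *
            ((omega m p : ℂ) * ((ξ₀ : ℂ) + (σ : ℂ) * Complex.I) - (⟪p, ξv⟫ : ℂ))) +
          Complex.exp (-(Complex.I *
            ((omega m p : ℂ) * ((ξ₀ : ℂ) + (σ : ℂ) * Complex.I) - (⟪p, ξv⟫ : ℂ)))) *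
            (Real.exp (-β * omega m p) : ℂ))

/-- KMS reflection (boundary-exchange) symmetry: F(−ξ, β−σ) = F(ξ, σ). -/
theorem thermalF_KMS_reflection (m β : ℝ) (hm : 0 ≤ m) (hβ : 0 < β)
    (ξ₀ : ℝ) (ξv : EuclideanSpace ℝ (Fin 3)) (σ : ℝ) (hσ : 0 < σ) (hσβ : σ < β) :
    thermalF m β (-ξ₀) (-ξv) (β - σ) = thermalF m β ξ₀ ξv σ := by
  unfold thermalF
  congr 2 with p
  congr 1
  rw [add_comm]
  push_cast
  rw [← Complex.exp_add, ← Complex.exp_add, inner_neg_right]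
  push_cast
  congr 2 <;> ring_nf <;> simp only [Complex.I_sq] <;> ring
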